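/- Let X be an (n,k)-source. For any real ℓ ∈ [0,k] and real g ≥ 0 such that m := k − ℓ + g is a (nonnegative) integer, any ε ∈ (0,1], and any set S ⊆ {0,1}^n with μ := |S|/M, the following holds. If f : {0,1}^n → {0,1}^m is a uniformly random function, then Pr_f[ |f(S)| = |S| and Pr_X[∃ v ∈ S : f(X) = f(v) and X ∈ SL_v] > μ·G + ε ] ≤ (eμ/ε)^{εK}, where K := 2^k, G := 2^g, M := 2^m. -/

import Mathlib

open Finset Real
open scoped Classical

/-- Bit strings of length `n`, i.e. `{0,1}^n`. -/
abbrev BS (n : ℕ) := Fin n → Bool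

/-- `p` is a probability mass function on a finite type. -/
def IsDist {α : Type*} [Fintype α] (p : α → ℝ) : Prop :=
  (∀ a, 0 ≤ p a) ∧ ∑ a, p a = 1

/-- Pushforward of a mass function `p` on `{0,1}^n` along `f : {0,1}^n → {0,1}^m`:
the distribution of `f(X)` when `X ∼ p`. -/
noncomputable def pushforward {n m : ℕ} (f : BS n → BS m) (p : BS n → ℝ) : BS m → ℝ :=
  fun v => ∑ x ∈ Finset.univ.filter (fun x => f x = v), p x

/-- Statistical (total variation) distance between two mass functions. -/
noncomputable def SD {α : Type*} [Fintype α] (p q : α → ℝ) : ℝ :=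
  (∑ a, |p a - q a|) / 2

/-- The `ε`-smooth min-entropy of the mass function `p`: the supremum of all `k'`
such that `p` is `ε`-close (in statistical distance) to some distribution with
min-entropy at least `k'` (i.e., all point masses at most `2^(-k')`). -/
noncomputable def smoothMinEntropy {α : Type*} [Fintype α] (p : α → ℝ) (ε : ℝ) : ℝ :=
  sSup {k' : ℝ | ∃ q : α → ℝ, IsDist q ∧ SD p q ≤ ε ∧ ∀ a, q a ≤ (2 : ℝ) ^ (-k')}

/-- Probability, over a uniformly random function `f : {0,1}^n → {0,1}^m`,
that the predicate `P f` holds. -/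
noncomputable def prF (n m : ℕ) (P : (BS n → BS m) → Prop) : ℝ :=
  ((Finset.univ.filter (fun f => P f)).card : ℝ) / (Fintype.card (BS n → BS m) : ℝ)

/-- Probability, over `X ∼ p`, of the event `A`. -/
noncomputable def prX {n : ℕ} (p : BS n → ℝ) (A : BS n → Prop) : ℝ :=
  ∑ x ∈ Finset.univ.filter (fun x => A x), p x

/-- The support of a mass function `p` on `{0,1}^n`. -/
noncomputable def supp {n : ℕ} (p : BS n → ℝ) : Finset (BS n) :=
  Finset.univ.filter (fun x => 0 < p x)

/-- The value of `f` at `x` lies in the image of `S` under `f`. -/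
def Collides {α β : Type*} (S : Finset α) (f : α → β) (x : α) : Prop :=
  ∃ v ∈ S, f x = f v

lemma sum_mem_add_sum_subtype_notMem {α : Type*} [Fintype α] [DecidableEq α]
    (S : Finset α) (F : α → ℝ) :
    ∑ x ∈ S, F x + ∑ x : {x // x ∉ S}, F x = ∑ x, F x := by
  rw [← Finset.sum_add_sum_compl S F]
  congr 1
  exact (Finset.sum_subtype Sᶜ (by simp) F).symm

/-- Tilted collision weights of a random function, conditioned on its restriction to `S`:
outside `S` the values are independent and hit the image of `S` with probability at most
`|S| / |β|`. -/
lemma sum_prod_ite_collision_le {α β : Type*} [Fintype α] [DecidableEq α] [Fintype β] [Nonempty β]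
    (S : Finset α) (c : α → ℝ) (hc : ∀ x, 1 ≤ c x) :
    ∑ f : α → β, ∏ x : {x // x ∉ S}, (if Collides S f x then c x else 1) ≤
      (Fintype.card (α → β) : ℝ) *
        ∏ x : {x // x ∉ S}, (1 + (S.card : ℝ) / Fintype.card β * (c x - 1)) := by
  have hβ : (0 : ℝ) < Fintype.card β := by exact_mod_cast Fintype.card_pos
  let e := Equiv.piEquivPiSubtypeProd (fun x : α => x ∈ S) (fun _ => β)
  have hsplit : ∑ f : α → β, ∏ x : {x // x ∉ S}, (if Collides S f x then c x else 1) =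
      ∑ q : ({x // x ∈ S} → β) × ({x // x ∉ S} → β), ∏ x : {x // x ∉ S},
        (if q.2 x ∈ Finset.univ.image q.1 then c x else 1) := by
    refine Fintype.sum_equiv e _ _ fun f => Finset.prod_congr rfl fun x _ => ?_
    refine if_congr ?_ rfl rfl
    simp [Collides, e, Equiv.piEquivPiSubtypeProd, eq_comm]
  have hpoint (T : Finset β) (hT : T.card ≤ S.card) (x : α) :
      ∑ y : β, (if y ∈ T then c x else 1) ≤
        (Fintype.card β : ℝ) * (1 + (S.card : ℝ) / Fintype.card β * (c x - 1)) := by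
    have hsum : ∑ y : β, (if y ∈ T then c x else 1) =
        (Fintype.card β : ℝ) + T.card * (c x - 1) := by
      have : ∀ y : β, (if y ∈ T then c x else 1) = 1 + (if y ∈ T then c x - 1 else 0) := by
        intro y; split_ifs <;> ring
      simp only [this, Finset.sum_add_distrib, Finset.sum_ite_mem, Finset.univ_inter]
      simp [mul_sub]
    have hT' : (T.card : ℝ) ≤ S.card := by exact_mod_cast hT
    calc _ = (Fintype.card β : ℝ) + T.card * (c x - 1) := hsum
      _ ≤ (Fintype.card β : ℝ) + S.card * (c x - 1) := by
        have := mul_le_mul_of_nonneg_right hT' (sub_nonneg.2 (hc x))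
        linarith
      _ = _ := by field_simp
  have hinner (a : {x // x ∈ S} → β) :
      ∑ b : {x // x ∉ S} → β, ∏ x : {x // x ∉ S},
        (if b x ∈ Finset.univ.image a then c x else 1) ≤
      (Fintype.card ({x // x ∉ S} → β) : ℝ) *
        ∏ x : {x // x ∉ S}, (1 + (S.card : ℝ) / Fintype.card β * (c x - 1)) := by
    have hT : (Finset.univ.image a).card ≤ S.card := by
      simpa using Finset.card_image_le (s := Finset.univ) (f := a)
    have hprod := Finset.prod_univ_sum (fun _ : {x // x ∉ S} => (Finset.univ : Finset β))
      (fun x y => if y ∈ Finset.univ.image a then c x else 1)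
    rw [Fintype.piFinset_univ] at hprod
    rw [← hprod]
    calc _ ≤ ∏ x : {x // x ∉ S},
          (Fintype.card β : ℝ) * (1 + (S.card : ℝ) / Fintype.card β * (c x - 1)) := by
          refine Finset.prod_le_prod (fun x _ => Finset.sum_nonneg fun y _ => ?_)
            fun x _ => hpoint _ hT x
          have := hc x
          split_ifs <;> linarith
      _ = _ := by
          rw [Finset.prod_mul_distrib, Fintype.card_fun]
          simp
  rw [hsplit, Fintype.sum_prod_type]
  calc _ ≤ ∑ _a : {x // x ∈ S} → β, (Fintype.card ({x // x ∉ S} → β) : ℝ) *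
        ∏ x : {x // x ∉ S}, (1 + (S.card : ℝ) / Fintype.card β * (c x - 1)) :=
        Finset.sum_le_sum fun a _ => hinner a
    _ = _ := by
        rw [Finset.sum_const, nsmul_eq_mul, Finset.card_univ, Fintype.card_congr e,
          Fintype.card_prod]
        push_cast
        ring

/-- Chernoff bound for the mass outside `S` that a random function maps into the image of `S`. -/
lemma prF_collision_mass_le {n m : ℕ} (p : BS n → ℝ) (S : Finset (BS n)) (hp : IsDist p)
    {K ε : ℝ} (hK : 0 < K) (hk : ∀ x, K * p x ≤ 1) (hS : S.Nonempty)
    (hε : (S.card : ℝ) / Fintype.card (BS m) ≤ ε) :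
    prF n m (fun f => ε < ∑ x : {x // x ∉ S}, if Collides S f x then p x else 0) ≤
      (Real.exp 1 * ((S.card : ℝ) / Fintype.card (BS m)) / ε) ^ (ε * K) := by
  set μ : ℝ := (S.card : ℝ) / Fintype.card (BS m) with hμdef
  have hμ : 0 < μ := by
    have : (0 : ℝ) < S.card := by exact_mod_cast hS.card_pos
    have : (0 : ℝ) < Fintype.card (BS m) := by exact_mod_cast Fintype.card_pos
    positivity
  have hε0 : 0 < ε := hμ.trans_le hε
  set r : ℝ := ε / μ with hr
  have hr1 : 1 ≤ r := (one_le_div hμ).2 hε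
  have hr0 : 0 < r := by linarith
  have hKp : ∀ x, 0 ≤ K * p x := fun x => mul_nonneg hK.le (hp.1 x)
  have hc : ∀ x, 1 ≤ r ^ (K * p x) := fun x => Real.one_le_rpow hr1 (hKp x)
  have hN : (0 : ℝ) < Fintype.card (BS n → BS m) := by exact_mod_cast Fintype.card_pos
  have hmass : ∑ x : {x // x ∉ S}, p x ≤ 1 := by
    have h := sum_mem_add_sum_subtype_notMem S p
    have h0 : 0 ≤ ∑ x ∈ S, p x := Finset.sum_nonneg fun x _ => hp.1 x
    have h1 := hp.2
    linarith
  have hfactor (x : BS n) :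
      1 + μ * (r ^ (K * p x) - 1) ≤ Real.exp (K * (ε - μ) * p x) := by
    have hb : r ^ (K * p x) ≤ 1 + K * p x * (r - 1) := by
      simpa using rpow_one_add_le_one_add_mul_self (s := r - 1) (by linarith) (hKp x) (hk x)
    have hrμ : μ * r = ε := by rw [hr]; field_simp
    calc 1 + μ * (r ^ (K * p x) - 1) ≤ 1 + μ * (K * p x * (r - 1)) := by gcongr; linarith
      _ = K * (μ * r - μ) * p x + 1 := by ring
      _ ≤ _ := by rw [hrμ]; exact Real.add_one_le_exp _
  have hprod : ∏ x : {x // x ∉ S}, (1 + μ * (r ^ (K * p x) - 1)) ≤ Real.exp (ε * K) := by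
    calc _ ≤ ∏ x : {x // x ∉ S}, Real.exp (K * (ε - μ) * p x) := by
          refine Finset.prod_le_prod (fun x _ => ?_) fun x _ => hfactor x
          have := mul_nonneg hμ.le (sub_nonneg.2 (hc x))
          linarith
      _ = Real.exp (K * (ε - μ) * ∑ x : {x // x ∉ S}, p x) := by
          rw [← Real.exp_sum, Finset.mul_sum]
      _ ≤ _ := by
          refine Real.exp_le_exp.2 ?_
          have h1 : 0 ≤ K * (ε - μ) := mul_nonneg hK.le (by linarith)
          have h2 := mul_le_mul_of_nonneg_left hmass h1
          nlinarith [mul_pos hK hμ]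
  have hmarkov : ((Finset.univ.filter (fun f : BS n → BS m =>
        ε < ∑ x : {x // x ∉ S}, if Collides S f x then p x else 0)).card : ℝ) *
        r ^ (ε * K) ≤
      ∑ f : BS n → BS m, ∏ x : {x // x ∉ S},
        (if Collides S f x then r ^ (K * p x) else 1) := by
    have hnn (f : BS n → BS m) : 0 ≤ ∏ x : {x // x ∉ S},
        (if Collides S f x then r ^ (K * p x) else 1) := by
      refine Finset.prod_nonneg fun x _ => ?_
      split_ifs <;> positivity
    rw [← nsmul_eq_mul, ← Finset.sum_const]
    refine le_trans (Finset.sum_le_sum fun f hf => ?_)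
      (Finset.sum_le_sum_of_subset_of_nonneg (Finset.subset_univ _) fun f _ _ => hnn f)
    have hf' := (Finset.mem_filter.1 hf).2
    have hexp : ∏ x : {x // x ∉ S}, (if Collides S f x then r ^ (K * p x) else 1) =
        r ^ ((∑ x : {x // x ∉ S}, if Collides S f x then p x else 0) * K) := by
      rw [Finset.sum_mul, Real.rpow_sum_of_pos hr0]
      refine Finset.prod_congr rfl fun x _ => ?_
      split_ifs
      · rw [mul_comm]
      · simp
    rw [hexp]
    exact Real.rpow_le_rpow_of_exponent_le hr1 (mul_le_mul_of_nonneg_right hf'.le hK.le)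
  have hrhs : (Real.exp 1 * μ / ε) ^ (ε * K) = Real.exp (ε * K) / r ^ (ε * K) := by
    have : Real.exp 1 * μ / ε = Real.exp 1 / r := by rw [hr]; field_simp
    rw [this, Real.div_rpow (Real.exp_pos 1).le hr0.le, ← Real.exp_mul, one_mul]
  rw [hrhs, prF, div_le_div_iff₀ hN (by positivity)]
  have hbound := sum_prod_ite_collision_le (β := BS m) S _ hc
  calc _ ≤ _ := hmarkov
    _ ≤ _ := hbound
    _ ≤ (Fintype.card (BS n → BS m) : ℝ) * Real.exp (ε * K) :=
      mul_le_mul_of_nonneg_left hprod hN.le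
    _ = _ := mul_comm _ _

lemma prF_mono {n m : ℕ} {P Q : (BS n → BS m) → Prop} (h : ∀ f, P f → Q f) :
    prF n m P ≤ prF n m Q := by
  unfold prF
  gcongr with f
  exact h f

lemma prF_le_one {n m : ℕ} (P : (BS n → BS m) → Prop) : prF n m P ≤ 1 := by
  unfold prF
  refine div_le_one_of_le₀ ?_ (Nat.cast_nonneg _)
  exact_mod_cast Finset.card_le_univ _

/-- preimage version of the meets-and-exceeds bound, via superlevel sets
`SL_v = {x : Pr[X = x] ≥ Pr[X = v]}`. -/
theorem stmt13 (n m : ℕ) (k ℓ g ε : ℝ) (p : BS n → ℝ) (S : Finset (BS n))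
    (hp : IsDist p) (hk : ∀ x, p x ≤ (2 : ℝ) ^ (-k))
    (hℓ0 : 0 ≤ ℓ) (hℓk : ℓ ≤ k) (hg : 0 ≤ g) (hm : (m : ℝ) = k - ℓ + g)
    (hε0 : 0 < ε) (hε1 : ε ≤ 1) :
    prF n m (fun f =>
        (S.image f).card = S.card ∧
        prX p (fun x => ∃ v ∈ S, f x = f v ∧ p v ≤ p x) >
          ((S.card : ℝ) / (2 : ℝ) ^ (m : ℝ)) * (2 : ℝ) ^ g + ε)
      ≤ (Real.exp 1 * ((S.card : ℝ) / (2 : ℝ) ^ (m : ℝ)) / ε) ^ (ε * (2 : ℝ) ^ k) := by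
  have hcard : (Fintype.card (BS m) : ℝ) = (2 : ℝ) ^ (m : ℝ) := by simp
  have hK : (0 : ℝ) < 2 ^ k := by positivity
  rcases S.eq_empty_or_nonempty with rfl | hS
  · have h0 : ¬ ((0 : ℝ) > ε) := by linarith
    simp only [prF, prX]
    simp [h0]
    positivity
  rcases le_total ((S.card : ℝ) / (2 : ℝ) ^ (m : ℝ)) ε with hle | hle
  · have hmain := prF_collision_mass_le (m := m) p S hp (K := (2 : ℝ) ^ k) (ε := ε) hK
      (fun x => by
        calc (2 : ℝ) ^ k * p x ≤ 2 ^ k * 2 ^ (-k) := mul_le_mul_of_nonneg_left (hk x) hK.le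
          _ = 1 := by rw [← Real.rpow_add two_pos]; simp) hS (by rwa [hcard])
    rw [hcard] at hmain
    refine (prF_mono fun f hf => ?_).trans hmain
    have hmass : prX p (fun x => ∃ v ∈ S, f x = f v ∧ p v ≤ p x) ≤
        ∑ x ∈ S, p x + ∑ x : {x // x ∉ S}, if Collides S f x then p x else 0 := by
      rw [prX, Finset.sum_filter, ← sum_mem_add_sum_subtype_notMem S]
      refine add_le_add (Finset.sum_le_sum fun x _ => ?_) (Finset.sum_le_sum fun x _ => ?_)
      · have := hp.1 x
        split_ifs <;> linarith
      · have := hp.1 x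
        split_ifs with h1 h2
        · exact le_rfl
        · exact absurd (h1.imp fun v hv => ⟨hv.1, hv.2.1⟩) h2
        · exact this
        · exact le_rfl
    have hSmass : ∑ x ∈ S, p x ≤ (S.card : ℝ) / 2 ^ (m : ℝ) * 2 ^ g := by
      calc ∑ x ∈ S, p x ≤ ∑ _x ∈ S, (2 : ℝ) ^ (-k) := Finset.sum_le_sum fun x _ => hk x
        _ = S.card * (2 : ℝ) ^ (-k) := by rw [Finset.sum_const, nsmul_eq_mul]
        _ ≤ S.card * (2 : ℝ) ^ (g - m) := by
          gcongr
          · norm_num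
          · linarith
        _ = _ := by rw [Real.rpow_sub two_pos]; ring
    have := hf.2
    linarith
  · refine (prF_le_one _).trans (Real.one_le_rpow ?_ (by positivity))
    rw [le_div_iff₀ hε0, one_mul]
    have he : (1 : ℝ) ≤ Real.exp 1 := Real.one_le_exp zero_le_one
    nlinarith
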